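/- Let W ∈ C¹(ℝᵐ;ℝ), m ≥ 1, be nonnegative with W(u) > 0 for all u ≠ a and W(a) = 0 for some point a ∈ ℝᵐ. Let u ∈ C²(ℝⁿ;ℝᵐ), n ≥ 2, be a bounded, globally minimizing solution of Δu = ∇W(u) on ℝⁿ. If u satisfies Modica's gradient bound (1/2)|∇u(x)|² ≤ W(u(x)) for all x ∈ ℝⁿ, then u ≡ a. -/

import Mathlib

open MeasureTheory Metric Filter RealInnerProductSpace

/-- Squared Frobenius norm of the gradient: `|∇u|² = Σᵢ |u_{xᵢ}|²`. -/
noncomputable def gradSq {n m : ℕ}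
    (u : EuclideanSpace ℝ (Fin n) → EuclideanSpace ℝ (Fin m))
    (x : EuclideanSpace ℝ (Fin n)) : ℝ :=
  ∑ i : Fin n, ‖fderiv ℝ u x (EuclideanSpace.single i 1)‖ ^ 2

/-- The Laplacian of `u`, computed componentwise: `Δu = Σᵢ u_{xᵢxᵢ}`. -/
noncomputable def vlap {n m : ℕ}
    (u : EuclideanSpace ℝ (Fin n) → EuclideanSpace ℝ (Fin m))
    (x : EuclideanSpace ℝ (Fin n)) : EuclideanSpace ℝ (Fin m) :=
  ∑ i : Fin n,
    fderiv ℝ (fun y => fderiv ℝ u y (EuclideanSpace.single i 1)) x (EuclideanSpace.single i 1)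

/-- The Allen–Cahn energy `E(u;Ω) = ∫_Ω ((1/2)|∇u|² + W(u)) dx`. -/
noncomputable def energy {n m : ℕ} (W : EuclideanSpace ℝ (Fin m) → ℝ)
    (u : EuclideanSpace ℝ (Fin n) → EuclideanSpace ℝ (Fin m))
    (Ω : Set (EuclideanSpace ℝ (Fin n))) : ℝ :=
  ∫ x in Ω, ((1 / 2) * gradSq u x + W (u x))

/-- `u` is a globally minimizing solution: for every bounded domain `Ω` and every
perturbation `φ ∈ W^{1,2}_0(Ω;ℝᵐ) ∩ L^∞(Ω;ℝᵐ)` (encoded as a Lipschitz, hence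
bounded and `W^{1,2}`, function supported in `Ω`), `E(u;Ω) ≤ E(u+φ;Ω)`. -/
def GloballyMinimizing {n m : ℕ} (W : EuclideanSpace ℝ (Fin m) → ℝ)
    (u : EuclideanSpace ℝ (Fin n) → EuclideanSpace ℝ (Fin m)) : Prop :=
  ∀ Ω : Set (EuclideanSpace ℝ (Fin n)), IsOpen Ω → Bornology.IsBounded Ω →
    ∀ φ : EuclideanSpace ℝ (Fin n) → EuclideanSpace ℝ (Fin m),
      (∃ K : NNReal, LipschitzWith K φ) → tsupport φ ⊆ Ω →
      energy W u Ω ≤ energy W (u + φ) Ω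


/-- Energy density. -/
noncomputable def dens {n m : ℕ} (W : EuclideanSpace ℝ (Fin m) → ℝ)
    (u : EuclideanSpace ℝ (Fin n) → EuclideanSpace ℝ (Fin m))
    (x : EuclideanSpace ℝ (Fin n)) : ℝ := (1 / 2) * gradSq u x + W (u x)

lemma gradSq_nonneg' {n m : ℕ} (u : EuclideanSpace ℝ (Fin n) → EuclideanSpace ℝ (Fin m))
    (x : EuclideanSpace ℝ (Fin n)) : 0 ≤ gradSq u x :=
  Finset.sum_nonneg fun _ _ => by positivity

lemma int_fderiv_zero {n : ℕ} (Y : EuclideanSpace ℝ (Fin n) → ℝ) (hY : ContDiff ℝ 1 Y)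
    (hc : HasCompactSupport Y) (v : EuclideanSpace ℝ (Fin n)) :
    ∫ x, fderiv ℝ Y x v = 0 := by
  have hcont : Continuous (fun x => fderiv ℝ Y x v) :=
    (hY.continuous_fderiv (by simp)).clm_apply continuous_const
  have hcs : HasCompactSupport (fun x => fderiv ℝ Y x v) := hc.fderiv_apply ℝ v
  have h := integral_bilinear_hasLineDerivAt_right_eq_neg_left_of_integrable
    (μ := (volume : Measure (EuclideanSpace ℝ (Fin n))))
    (f := fun _ => (1 : ℝ)) (f' := fun _ => (0 : ℝ)) (g := Y) (g' := fun x => fderiv ℝ Y x v)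
    (v := v) (B := ContinuousLinearMap.mul ℝ ℝ)
    (by simp) (by simpa using hcont.integrable_of_hasCompactSupport hcs)
    (by simpa using hY.continuous.integrable_of_hasCompactSupport hc)
    (fun x _ => (hasFDerivAt_const (1 : ℝ) x).hasLineDerivAt v)
    (fun x _ => ((hY.differentiable (by simp)) x).hasFDerivAt.hasLineDerivAt v)
  simpa using h

lemma contDiff_gradSq {n m : ℕ} {u : EuclideanSpace ℝ (Fin n) → EuclideanSpace ℝ (Fin m)}
    (hu : ContDiff ℝ 2 u) : ContDiff ℝ 1 (gradSq u) := by
  have h1 : ContDiff ℝ 1 (fderiv ℝ u) := hu.fderiv_right (by norm_num)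
  unfold gradSq
  exact ContDiff.sum fun i _ => (h1.clm_apply contDiff_const).norm_sq ℝ

lemma continuous_gradSq {n m : ℕ} {u : EuclideanSpace ℝ (Fin n) → EuclideanSpace ℝ (Fin m)}
    (hu : ContDiff ℝ 1 u) : Continuous (gradSq u) := by
  have h1 : Continuous (fderiv ℝ u) := hu.continuous_fderiv (by simp)
  unfold gradSq
  fun_prop

lemma contDiff_dens {n m : ℕ} {u : EuclideanSpace ℝ (Fin n) → EuclideanSpace ℝ (Fin m)}
    {W : EuclideanSpace ℝ (Fin m) → ℝ} (hW : ContDiff ℝ 1 W)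
    (hu : ContDiff ℝ 2 u) : ContDiff ℝ 1 (dens W u) := by
  have h1 := contDiff_gradSq hu
  unfold dens
  exact (contDiff_const.mul h1).add (hW.comp (hu.of_le (by norm_num)))

lemma sum_coord {n : ℕ} (x : EuclideanSpace ℝ (Fin n)) :
    ∑ i : Fin n, x i • (EuclideanSpace.single i (1 : ℝ) : EuclideanSpace ℝ (Fin n)) = x := by
  simpa using (EuclideanSpace.basisFun (Fin n) ℝ).sum_repr x

/-- The divergence identity for the stress tensor contracted with `η x`. -/
lemma stress_div {n m : ℕ} {u : EuclideanSpace ℝ (Fin n) → EuclideanSpace ℝ (Fin m)}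
    {W : EuclideanSpace ℝ (Fin m) → ℝ} (hW : ContDiff ℝ 1 W)
    (hu : ContDiff ℝ 2 u) (hsol : ∀ x, vlap u x = gradient W (u x))
    (η c : EuclideanSpace ℝ (Fin n) → ℝ)
    (hη : ∀ x, HasFDerivAt η (c x • innerSL ℝ x) x) (x : EuclideanSpace ℝ (Fin n)) :
    ∑ i : Fin n, fderiv ℝ (fun y => η y *
      (⟪fderiv ℝ u y (EuclideanSpace.single i 1), fderiv ℝ u y y⟫ - y i * dens W u y)) x
        (EuclideanSpace.single i 1)
    = η x * (gradSq u x - n * dens W u x)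
      + c x * (‖fderiv ℝ u x x‖ ^ 2 - ‖x‖ ^ 2 * dens W u x) := by
  have h1 : ContDiff ℝ 1 (fderiv ℝ u) := hu.fderiv_right (by norm_num)
  set D := fderiv ℝ (fderiv ℝ u) x with hD
  have hDx : HasFDerivAt (fderiv ℝ u) D x := ((h1.differentiable (by simp)) x).hasFDerivAt
  have hux : HasFDerivAt u (fderiv ℝ u x) x := ((hu.differentiable (by simp)) x).hasFDerivAt
  have hWx : HasFDerivAt W (fderiv ℝ W (u x)) (u x) :=
    ((hW.differentiable (by simp)) _).hasFDerivAt
  have hsymm : ∀ v w, D v w = D w v := by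
    have := hu.contDiffAt (x := x) |>.isSymmSndFDerivAt (by simp)
    exact fun v w => this v w
  have hpart : ∀ i : Fin n, HasFDerivAt (fun y => fderiv ℝ u y (EuclideanSpace.single i 1))
      (D.flip (EuclideanSpace.single i 1)) x := by
    intro i
    have := hDx.clm_apply (hasFDerivAt_const (EuclideanSpace.single i (1:ℝ)) x)
    simpa using this
  have hrad : HasFDerivAt (fun y => fderiv ℝ u y y) (fderiv ℝ u x + D.flip x) x := by
    have := hDx.clm_apply (hasFDerivAt_id x)
    simpa using this
  have hlap : ∑ i : Fin n, D (EuclideanSpace.single i 1) (EuclideanSpace.single i 1)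
      = gradient W (u x) := by
    rw [← hsol x]
    unfold vlap
    refine Finset.sum_congr rfl fun i _ => ?_
    rw [(hpart i).fderiv]; rfl
  have hdensd : HasFDerivAt (dens W u) (∑ i : Fin n,
      (innerSL ℝ (fderiv ℝ u x (EuclideanSpace.single i 1))).comp
        (D.flip (EuclideanSpace.single i 1)) + (fderiv ℝ W (u x)).comp (fderiv ℝ u x)) x := by
    have hs := HasFDerivAt.fun_sum (u := Finset.univ) fun i _ => (hpart i).norm_sq
    have := (hs.const_mul (1/2 : ℝ)).add (hWx.comp x hux)
    refine this.congr_fderiv ?_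
    congr 1
    rw [← Finset.smul_sum]
    module
  have hcoord : ∀ i : Fin n, HasFDerivAt (fun y : EuclideanSpace ℝ (Fin n) => y i)
      (EuclideanSpace.proj i : EuclideanSpace ℝ (Fin n) →L[ℝ] ℝ) x :=
    fun i => (EuclideanSpace.proj i : EuclideanSpace ℝ (Fin n) →L[ℝ] ℝ).hasFDerivAt
  set P := ∑ i : Fin n, ⟪fderiv ℝ u x (EuclideanSpace.single i 1),
    D x (EuclideanSpace.single i 1)⟫ with hP
  have hterm : ∀ i : Fin n, fderiv ℝ (fun y => η y *
      (⟪fderiv ℝ u y (EuclideanSpace.single i 1), fderiv ℝ u y y⟫ - y i * dens W u y)) x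
        (EuclideanSpace.single i 1) =
      η x * (⟪D (EuclideanSpace.single i 1) (EuclideanSpace.single i 1), fderiv ℝ u x x⟫
        + ⟪fderiv ℝ u x (EuclideanSpace.single i 1), D x (EuclideanSpace.single i 1)⟫
        + ‖fderiv ℝ u x (EuclideanSpace.single i 1)‖ ^ 2 - dens W u x
        - fderiv ℝ (dens W u) x (x i • EuclideanSpace.single i 1))
      + c x * (⟪fderiv ℝ u x (x i • EuclideanSpace.single i 1), fderiv ℝ u x x⟫
        - x i ^ 2 * dens W u x) := by
    intro i
    have h := (hη x).fun_mul (((hpart i).inner ℝ hrad).fun_sub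
      ((hcoord i).fun_mul hdensd.differentiableAt.hasFDerivAt))
    rw [h.fderiv]
    have hin : ⟪x, EuclideanSpace.single i (1:ℝ)⟫ = x i := by
      simp [EuclideanSpace.inner_single_right]
    have hps : (EuclideanSpace.proj i : EuclideanSpace ℝ (Fin n) →L[ℝ] ℝ)
      (EuclideanSpace.single i 1) = 1 := by simp
    simp only [_root_.add_apply, _root_.smul_apply,
      _root_.sub_apply, ContinuousLinearMap.comp_apply, innerSL_apply_apply, hin, hps,
      fderivInnerCLM_apply, ContinuousLinearMap.prod_apply, ContinuousLinearMap.flip_apply,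
      smul_eq_mul, map_smul, inner_add_right, real_inner_self_eq_norm_sq, inner_smul_left,
      hsymm (EuclideanSpace.single i 1) x, RCLike.conj_to_real]
    ring
  rw [Finset.sum_congr rfl fun i _ => hterm i, Finset.sum_add_distrib, ← Finset.mul_sum,
    ← Finset.mul_sum]
  simp only [Finset.sum_sub_distrib, Finset.sum_add_distrib]
  rw [← sum_inner, ← sum_inner, hlap, ← map_sum, ← map_sum, sum_coord, ← hP, ← Finset.sum_mul]
  have hnx : ∑ i : Fin n, x i ^ 2 = ‖x‖ ^ 2 := by
    rw [EuclideanSpace.norm_sq_eq]; simp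
  have hgr : ⟪gradient W (u x), fderiv ℝ u x x⟫ = fderiv ℝ W (u x) (fderiv ℝ u x x) := by
    rw [← toDual_gradient]; simp
  have hdx : fderiv ℝ (dens W u) x x = P + fderiv ℝ W (u x) (fderiv ℝ u x x) := by
    rw [hdensd.fderiv]
    simp [hP]
  rw [hnx, hgr, hdx, real_inner_self_eq_norm_sq]
  simp only [Finset.sum_const, Finset.card_univ, Fintype.card_fin, nsmul_eq_mul]
  rw [show (∑ i : Fin n, ‖fderiv ℝ u x (EuclideanSpace.single i 1)‖ ^ 2) = gradSq u x from rfl]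
  ring

/-- Monotonicity inequality in weak (cut-off) form. -/
lemma weak_monotonicity {n m : ℕ} {u : EuclideanSpace ℝ (Fin n) → EuclideanSpace ℝ (Fin m)}
    {W : EuclideanSpace ℝ (Fin m) → ℝ} (hW : ContDiff ℝ 1 W)
    (hu : ContDiff ℝ 2 u) (hsol : ∀ x, vlap u x = gradient W (u x))
    (hmodica : ∀ x, (1 / 2) * gradSq u x ≤ W (u x))
    (η c : EuclideanSpace ℝ (Fin n) → ℝ) (hη1 : ContDiff ℝ 1 η) (hcs : HasCompactSupport η)
    (hη : ∀ x, HasFDerivAt η (c x • innerSL ℝ x) x) (hη0 : ∀ x, 0 ≤ η x) (hc0 : ∀ x, c x ≤ 0)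
    (G : EuclideanSpace ℝ (Fin n) → ℝ) (hG : Integrable G)
    (hGle : ∀ x, G x ≤ dens W u x * ((n - 1) * η x + ‖x‖ ^ 2 * c x)) :
    ∫ x, G x ≤ 0 := by
  have h1 : ContDiff ℝ 1 (fderiv ℝ u) := hu.fderiv_right (by norm_num)
  have hde := contDiff_dens hW hu
  set Y : Fin n → EuclideanSpace ℝ (Fin n) → ℝ := fun i y => η y *
      (⟪fderiv ℝ u y (EuclideanSpace.single i 1), fderiv ℝ u y y⟫ - y i * dens W u y) with hYdef
  have hYc : ∀ i, ContDiff ℝ 1 (Y i) := by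
    intro i
    refine hη1.mul ((ContDiff.inner ℝ (h1.clm_apply contDiff_const)
      (h1.clm_apply contDiff_id)).sub (ContDiff.mul ?_ hde))
    exact (EuclideanSpace.proj i : EuclideanSpace ℝ (Fin n) →L[ℝ] ℝ).contDiff
  have hYs : ∀ i, HasCompactSupport (Y i) := fun i => hcs.mul_right
  have hint : ∀ i, Integrable (fun x => fderiv ℝ (Y i) x (EuclideanSpace.single i 1)) := fun i =>
    (((hYc i).continuous_fderiv (by simp)).clm_apply
      continuous_const).integrable_of_hasCompactSupport ((hYs i).fderiv_apply ℝ _)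
  have hz : ∫ x, ∑ i, fderiv ℝ (Y i) x (EuclideanSpace.single i 1) = 0 := by
    rw [integral_finsetSum _ fun i _ => hint i]
    exact Finset.sum_eq_zero fun i _ => int_fderiv_zero _ (hYc i) (hYs i) _
  have hS : Integrable (fun x => ∑ i, fderiv ℝ (Y i) x (EuclideanSpace.single i 1)) :=
    integrable_finsetSum _ fun i _ => hint i
  have hle : ∫ x, G x ≤ ∫ x, -(∑ i, fderiv ℝ (Y i) x (EuclideanSpace.single i 1)) := by
    refine integral_mono hG hS.neg fun x => ?_
    refine (hGle x).trans ?_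
    have := stress_div hW hu hsol η c hη x
    simp only [hYdef]
    rw [this]
    have a1 : gradSq u x ≤ dens W u x := by unfold dens; linarith [hmodica x]
    have a2 := mul_nonneg (hη0 x) (sub_nonneg.2 a1)
    have a3 := mul_nonneg (neg_nonneg.2 (hc0 x)) (sq_nonneg ‖fderiv ℝ u x x‖)
    nlinarith
  rw [integral_neg, hz] at hle
  simpa using hle

/-- The smoothed radius. -/
noncomputable def rho {n : ℕ} (x : EuclideanSpace ℝ (Fin n)) : ℝ := Real.sqrt (1 + ‖x‖ ^ 2)

lemma rho_sq {n : ℕ} (x : EuclideanSpace ℝ (Fin n)) : rho x ^ 2 = 1 + ‖x‖ ^ 2 :=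
  Real.sq_sqrt (by positivity)

lemma rho_ge_one {n : ℕ} (x : EuclideanSpace ℝ (Fin n)) : 1 ≤ rho x :=
  Real.one_le_sqrt.2 (by nlinarith [sq_nonneg ‖x‖])

lemma rho_pos {n : ℕ} (x : EuclideanSpace ℝ (Fin n)) : 0 < rho x :=
  lt_of_lt_of_le one_pos (rho_ge_one x)

lemma norm_le_rho {n : ℕ} (x : EuclideanSpace ℝ (Fin n)) : ‖x‖ ≤ rho x :=
  Real.le_sqrt_of_sq_le (by linarith)

lemma contDiff_rho {n : ℕ} : ContDiff ℝ 1 (rho : EuclideanSpace ℝ (Fin n) → ℝ) := by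
  unfold rho
  exact (contDiff_const.add (contDiff_norm_sq ℝ)).sqrt fun x => by positivity

lemma continuous_rho {n : ℕ} : Continuous (rho : EuclideanSpace ℝ (Fin n) → ℝ) :=
  contDiff_rho.continuous

lemma hasFDerivAt_rho {n : ℕ} (x : EuclideanSpace ℝ (Fin n)) :
    HasFDerivAt rho ((rho x)⁻¹ • innerSL ℝ x) x := by
  have h := (((hasFDerivAt_id x).norm_sq).const_add (1 : ℝ)).sqrt
    (by positivity)
  refine h.congr_fderiv ?_
  ext v
  simp [rho]
  ring

/-- Sublevel sets of the smoothed radius. -/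
def SS (n : ℕ) (r : ℝ) : Set (EuclideanSpace ℝ (Fin n)) := {x | rho x < r}

lemma isOpen_SS (n : ℕ) (r : ℝ) : IsOpen (SS n r) := isOpen_lt continuous_rho continuous_const

lemma SS_sub_ball (n : ℕ) (r : ℝ) : SS n r ⊆ ball 0 r := fun x hx => by
  simpa using (norm_le_rho x).trans_lt hx

lemma SS_mono (n : ℕ) {r s : ℝ} (h : r ≤ s) : SS n r ⊆ SS n s := fun _ hx => lt_of_lt_of_le hx h

lemma compact_rho_le (n : ℕ) (r : ℝ) : IsCompact {x : EuclideanSpace ℝ (Fin n) | rho x ≤ r} := by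
  refine (isCompact_closedBall 0 r).of_isClosed_subset
    (isClosed_le continuous_rho continuous_const) fun x hx => ?_
  simpa using (norm_le_rho x).trans hx

lemma integrableOn_SS {n : ℕ} (r : ℝ) {f : EuclideanSpace ℝ (Fin n) → ℝ} (hf : Continuous f) :
    IntegrableOn f (SS n r) :=
  (hf.continuousOn.integrableOn_compact (compact_rho_le n r)).mono_set
    fun x (hx : rho x < r) => (le_of_lt hx : rho x ≤ r)

lemma tau_deriv : ∃ K : ℝ, 0 ≤ K ∧ ∀ t, 0 ≤ deriv Real.smoothTransition t ∧
    deriv Real.smoothTransition t ≤ K ∧ (t < 0 → deriv Real.smoothTransition t = 0) ∧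
    (1 < t → deriv Real.smoothTransition t = 0) := by
  have hc : Continuous (deriv Real.smoothTransition) :=
    (Real.smoothTransition.contDiff (n := 1)).continuous_deriv (by simp)
  obtain ⟨K, hK⟩ := (isCompact_Icc (a := (0:ℝ)) (b := 1)).exists_bound_of_continuousOn
    hc.continuousOn
  have h0 : ∀ t < 0, deriv Real.smoothTransition t = 0 := by
    intro t ht
    have : Real.smoothTransition =ᶠ[nhds t] fun _ => 0 := by
      filter_upwards [Iio_mem_nhds ht] with s hs using
        Real.smoothTransition.zero_of_nonpos (le_of_lt hs)
    rw [this.deriv_eq]; simp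
  have h1 : ∀ t > 1, deriv Real.smoothTransition t = 0 := by
    intro t ht
    have : Real.smoothTransition =ᶠ[nhds t] fun _ => 1 := by
      filter_upwards [Ioi_mem_nhds ht] with s hs using
        Real.smoothTransition.one_of_one_le (le_of_lt hs)
    rw [this.deriv_eq]; simp
  have hK0 : 0 ≤ K := (norm_nonneg _).trans (hK 0 (by simp))
  refine ⟨K, hK0, fun t => ⟨Real.smoothTransition.monotone.deriv_nonneg, ?_, h0 t, h1 t⟩⟩
  rcases lt_or_ge t 0 with h | h
  · rw [h0 t h]; exact hK0
  rcases lt_or_ge 1 t with h' | h'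
  · rw [h1 t h']; exact hK0
  exact (le_abs_self _).trans (hK t ⟨h, h'⟩)

lemma tau_hasDerivAt (t : ℝ) :
    HasDerivAt Real.smoothTransition (deriv Real.smoothTransition t) t :=
  ((Real.smoothTransition.contDiff (n := 1)).differentiable (by simp) t).hasDerivAt

/-- Pointwise potential comparison. -/
lemma pot_compare {m : ℕ} {W : EuclideanSpace ℝ (Fin m) → ℝ} (hW : Continuous W)
    {a : EuclideanSpace ℝ (Fin m)} (hWa : W a = 0) (hWpos : ∀ v, v ≠ a → 0 < W v)
    {B M ε : ℝ} (hB : 0 ≤ B) (hM : 0 ≤ M) (hε : 0 < ε) :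
    ∃ C : ℝ, 0 ≤ C ∧ ∀ z, ‖z - a‖ ≤ M → ∀ t : ℝ, 0 ≤ t → t ≤ 1 →
      B * ‖z - a‖ ^ 2 + W (a + t • (z - a)) ≤ ε + C * W z := by
  have hW0 : ∀ v, 0 ≤ W v := fun v => by
    by_cases h : v = a
    · rw [h, hWa]
    · exact (hWpos v h).le
  obtain ⟨Q, hQ⟩ := (isCompact_closedBall a M).exists_bound_of_continuousOn hW.continuousOn
  have hQ0 : 0 ≤ Q := (norm_nonneg _).trans (hQ a (by simpa using hM))
  have hcont : Continuous (fun z => B * ‖z - a‖ ^ 2) := by fun_prop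
  have e1 : ∀ᶠ z in nhds a, B * ‖z - a‖ ^ 2 < ε / 2 :=
    hcont.continuousAt.eventually_lt_const (by simpa using hε)
  have e2 : ∀ᶠ z in nhds a, W z < ε / 2 :=
    hW.continuousAt.eventually_lt_const (by rw [hWa]; linarith)
  obtain ⟨δ, hδ, hball⟩ := Metric.eventually_nhds_iff.1 (e1.and e2)
  have hscale : ∀ z, ∀ t : ℝ, 0 ≤ t → t ≤ 1 → dist (a + t • (z - a)) a ≤ ‖z - a‖ := by
    intro z t h0 h1
    rw [dist_eq_norm, add_sub_cancel_left, norm_smul, Real.norm_of_nonneg h0]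
    exact mul_le_of_le_one_left (norm_nonneg _) h1
  have hw0 : ∃ w > 0, ∀ z, ‖z - a‖ ≤ M → δ ≤ ‖z - a‖ → w ≤ W z := by
    have hcomp : IsCompact (closedBall a M \ ball a δ) := (isCompact_closedBall a M).diff isOpen_ball
    rcases (closedBall a M \ ball a δ).eq_empty_or_nonempty with h | h
    · refine ⟨1, one_pos, fun z h1 h2 => ?_⟩
      have : z ∈ closedBall a M \ ball a δ := by
        simp [dist_eq_norm, h1, h2]
      rw [h] at this; exact this.elim
    · obtain ⟨z0, hz0, hmin⟩ := hcomp.exists_isMinOn h hW.continuousOn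
      refine ⟨W z0, hWpos z0 ?_, fun z h1 h2 => hmin (by simp [dist_eq_norm, h1, h2])⟩
      rintro rfl
      exact hz0.2 (by simpa using hδ)
  obtain ⟨w, hw, hwle⟩ := hw0
  refine ⟨(B * M ^ 2 + Q) / w, by positivity, fun z hz t h0 h1 => ?_⟩
  rcases lt_or_ge ‖z - a‖ δ with h | h
  · have a1 := (hball (show dist z a < δ by rwa [dist_eq_norm])).1
    have a2 := (hball ((hscale z t h0 h1).trans_lt h)).2
    have : 0 ≤ (B * M ^ 2 + Q) / w * W z := mul_nonneg (by positivity) (hW0 z)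
    linarith
  · have a1 : B * ‖z - a‖ ^ 2 ≤ B * M ^ 2 := by gcongr
    have a2 : W (a + t • (z - a)) ≤ Q :=
      (le_abs_self _).trans (hQ _ (by simpa using (hscale z t h0 h1).trans hz))
    have a3 : B * M ^ 2 + Q ≤ (B * M ^ 2 + Q) / w * W z := by
      rw [div_mul_eq_mul_div, le_div_iff₀ hw]
      exact mul_le_mul_of_nonneg_left (hwle z hz h) (by positivity)
    linarith

/-- Energy in sublevel sets. -/
noncomputable def AA {n m : ℕ} (W : EuclideanSpace ℝ (Fin m) → ℝ)
    (u : EuclideanSpace ℝ (Fin n) → EuclideanSpace ℝ (Fin m)) (r : ℝ) : ℝ :=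
  ∫ x in SS n r, dens W u x

/-- Volume of sublevel sets. -/
noncomputable def VV (n : ℕ) (r : ℝ) : ℝ := ∫ _x in SS n r, (1 : ℝ)

lemma layer_ineq {n m : ℕ} {W : EuclideanSpace ℝ (Fin m) → ℝ} (hW : ContDiff ℝ 1 W)
    {a : EuclideanSpace ℝ (Fin m)} (hWa : W a = 0) (hWpos : ∀ v, v ≠ a → 0 < W v)
    {u : EuclideanSpace ℝ (Fin n) → EuclideanSpace ℝ (Fin m)} (hu : ContDiff ℝ 2 u)
    (hbdd : ∃ C, ∀ x, ‖u x‖ ≤ C) (hmin : GloballyMinimizing W u) {ε : ℝ} (hε : 0 < ε) :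
    ∃ C : ℝ, 0 ≤ C ∧ ∀ r : ℝ,
      AA W u r ≤ ε * (VV n (r + 2) - VV n r) + C * (AA W u (r + 2) - AA W u r) := by
  have hW0 : ∀ v, 0 ≤ W v := fun v => by
    by_cases h : v = a
    · rw [h, hWa]
    · exact (hWpos v h).le
  obtain ⟨C0, hC0⟩ := hbdd
  obtain ⟨K, hK0, hK⟩ := tau_deriv
  have hMb : ∀ x, ‖u x - a‖ ≤ C0 + ‖a‖ := fun x =>
    (norm_sub_le _ _).trans (by linarith [hC0 x])
  have hM : 0 ≤ C0 + ‖a‖ := (norm_nonneg _).trans (hMb 0)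
  obtain ⟨C, hC, hcomp⟩ := pot_compare hW.continuous hWa hWpos
    (B := n * K ^ 2) (by positivity) hM hε
  refine ⟨2 + C, by positivity, fun r => ?_⟩
  have hu1 : ContDiff ℝ 1 u := hu.of_le (by norm_num)
  have hdu0 : ∀ x, 0 ≤ dens W u x := fun x => by
    have := gradSq_nonneg' u x
    have := hW0 (u x)
    unfold dens; linarith
  have hduc : Continuous (dens W u) := (contDiff_dens hW hu).continuous
  set ζ : EuclideanSpace ℝ (Fin n) → ℝ := fun x => Real.smoothTransition (rho x - r) with hζ
  have hζd : ∀ x, HasFDerivAt ζ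
      (deriv Real.smoothTransition (rho x - r) • ((rho x)⁻¹ • innerSL ℝ x)) x := fun x =>
    HasDerivAt.comp_hasFDerivAt (f := fun y => rho y - r) x (tau_hasDerivAt (rho x - r))
      ((hasFDerivAt_rho x).sub_const r)
  have hζc : ContDiff ℝ 1 ζ :=
    (Real.smoothTransition.contDiff (n := 1)).comp (contDiff_rho.sub contDiff_const)
  set φ : EuclideanSpace ℝ (Fin n) → EuclideanSpace ℝ (Fin m) :=
    fun x => (ζ x - 1) • (u x - a) with hφ
  have hφc : ContDiff ℝ 1 φ := (hζc.sub contDiff_const).smul (hu1.sub contDiff_const)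
  have hφs : tsupport φ ⊆ {x | rho x ≤ r + 1} := by
    refine closure_minimal (fun x hx => ?_) (isClosed_le continuous_rho continuous_const)
    by_contra hlt
    simp only [Set.mem_ofPred_eq, not_le] at hlt
    apply hx
    simp [hφ, hζ, Real.smoothTransition.one_of_one_le (by linarith : 1 ≤ rho x - r)]
  have hφcs : HasCompactSupport φ :=
    (compact_rho_le n (r + 1)).of_isClosed_subset (isClosed_tsupport φ) hφs
  have hE := hmin (SS n (r + 2)) (isOpen_SS n _) (isBounded_ball.subset (SS_sub_ball n _)) φ
    (ContDiff.lipschitzWith_of_hasCompactSupport hφcs hφc (by simp))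
    (hφs.trans fun x (hx : rho x ≤ r + 1) => (by linarith : rho x < r + 2))
  have hvc : ContDiff ℝ 1 (u + φ) := hu1.add hφc
  have hval : ∀ x, (u + φ) x = a + ζ x • (u x - a) := fun x => by
    simp only [Pi.add_apply, hφ]; module
  have hvd : ∀ x v, fderiv ℝ (u + φ) x v = ζ x • fderiv ℝ u x v +
      (deriv Real.smoothTransition (rho x - r) * ((rho x)⁻¹ * ⟪x, v⟫)) • (u x - a) := by
    intro x v
    have h := ((hζd x).fun_smul
      (((hu1.differentiable (by simp) x).hasFDerivAt).sub_const a)).const_add a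
    have hfun : (u + φ) = fun y => a + ζ y • (u y - a) := funext hval
    rw [hfun, h.fderiv]
    simp
  have hzero : ∀ x ∈ SS n r, dens W (u + φ) x = 0 := by
    intro x hx
    have h1 : rho x - r < 0 := sub_neg.2 hx
    have hz : ζ x = 0 := Real.smoothTransition.zero_of_nonpos h1.le
    have hd := (hK (rho x - r)).2.2.1 h1
    unfold dens gradSq
    simp only [hvd, hval, hz, hd]
    simp [hWa]
  have hle : ∀ x, dens W (u + φ) x ≤ ε + (2 + C) * dens W u x := by
    intro x
    have hg : gradSq (u + φ) x ≤ 2 * gradSq u x + 2 * (n * K ^ 2 * ‖u x - a‖ ^ 2) := by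
      have : ∀ i : Fin n, ‖fderiv ℝ (u + φ) x (EuclideanSpace.single i 1)‖ ^ 2 ≤
          2 * ‖fderiv ℝ u x (EuclideanSpace.single i 1)‖ ^ 2 + 2 * (K ^ 2 * ‖u x - a‖ ^ 2) := by
        intro i
        rw [hvd]
        set p := fderiv ℝ u x (EuclideanSpace.single i 1)
        set s := deriv Real.smoothTransition (rho x - r) *
          ((rho x)⁻¹ * ⟪x, EuclideanSpace.single i (1:ℝ)⟫) with hs
        have hs' : |s| ≤ K := by
          have h1 : |⟪x, EuclideanSpace.single i (1:ℝ)⟫| ≤ rho x :=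
            (abs_real_inner_le_norm _ _).trans (by simpa using norm_le_rho x)
          have h2 : |(rho x)⁻¹ * ⟪x, EuclideanSpace.single i (1:ℝ)⟫| ≤ 1 := by
            rw [abs_mul, abs_of_pos (inv_pos.2 (rho_pos x)), inv_mul_le_iff₀ (rho_pos x)]
            linarith
          rw [hs, abs_mul, abs_of_nonneg (hK _).1]
          calc _ ≤ K * 1 := mul_le_mul (hK _).2.1 h2 (abs_nonneg _) hK0
            _ = K := mul_one K
        have hz0 : |ζ x| ≤ 1 := by
          rw [abs_of_nonneg (Real.smoothTransition.nonneg _)]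
          exact Real.smoothTransition.le_one _
        have hn : ‖ζ x • p + s • (u x - a)‖ ≤ ‖p‖ + K * ‖u x - a‖ := by
          refine (norm_add_le _ _).trans (add_le_add ?_ ?_)
          · rw [norm_smul]; exact mul_le_of_le_one_left (norm_nonneg _) hz0
          · rw [norm_smul]; exact mul_le_mul_of_nonneg_right hs' (norm_nonneg _)
        calc _ ≤ (‖p‖ + K * ‖u x - a‖) ^ 2 := by gcongr
          _ ≤ _ := by nlinarith [sq_nonneg (‖p‖ - K * ‖u x - a‖)]
      calc gradSq (u + φ) x ≤ ∑ i : Fin n, (2 * ‖fderiv ℝ u x (EuclideanSpace.single i 1)‖ ^ 2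
            + 2 * (K ^ 2 * ‖u x - a‖ ^ 2)) := Finset.sum_le_sum fun i _ => this i
        _ = _ := by
          rw [Finset.sum_add_distrib, ← Finset.mul_sum]
          simp [gradSq]; ring
    have hc := hcomp (u x) (hMb x) (ζ x) (Real.smoothTransition.nonneg _)
      (Real.smoothTransition.le_one _)
    have hWu := hW0 (u x)
    have hgu := gradSq_nonneg' u x
    have h3 : 0 ≤ C * gradSq u x := mul_nonneg hC hgu
    unfold dens
    rw [hval]
    nlinarith
  have hsub : SS n r ⊆ SS n (r + 2) := SS_mono n (by linarith)
  have hdvc : Continuous (dens W (u + φ)) := by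
    have := continuous_gradSq hvc
    have := hW.continuous.comp hvc.continuous
    unfold dens
    exact (continuous_const.mul (continuous_gradSq hvc)).add this
  have hmeas : MeasurableSet (SS n r) := (isOpen_SS n r).measurableSet
  have hsplit : ∀ f : EuclideanSpace ℝ (Fin n) → ℝ, Continuous f →
      ∫ x in SS n (r + 2) \ SS n r, f x = (∫ x in SS n (r+2), f x) - ∫ x in SS n r, f x :=
    fun f hf => setIntegral_sdiff hmeas (integrableOn_SS _ hf) hsub
  have h1 : AA W u (r + 2) ≤ ∫ x in SS n (r + 2), dens W (u + φ) x := hE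
  have h2 : ∫ x in SS n r, dens W (u + φ) x = 0 :=
    setIntegral_eq_zero_of_forall_eq_zero hzero
  have h3 : AA W u r ≤ AA W u (r + 2) :=
    setIntegral_mono_set (integrableOn_SS _ hduc) (Eventually.of_forall hdu0)
      (LE.le.eventuallyLE hsub)
  have hcont2 : Continuous (fun x => ε + (2 + C) * dens W u x) := by fun_prop
  have h4 : ∫ x in SS n (r + 2) \ SS n r, dens W (u + φ) x ≤
      ∫ x in SS n (r + 2) \ SS n r, (ε + (2 + C) * dens W u x) :=
    setIntegral_mono ((integrableOn_SS _ hdvc).mono_set Set.sdiff_subset)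
      ((integrableOn_SS _ hcont2).mono_set Set.sdiff_subset) hle
  have h5 : ∀ s, ∫ x in SS n s, (ε + (2 + C) * dens W u x) = ε * VV n s + (2 + C) * AA W u s := by
    intro s
    rw [integral_add (integrableOn_SS s continuous_const)
      (integrableOn_SS s (show Continuous (fun x => (2 + C) * dens W u x) by fun_prop)),
      integral_const_mul]
    congr 1
    rw [VV, ← integral_const_mul]; simp
  rw [hsplit _ hdvc, hsplit _ hcont2, h5, h5, h2] at h4
  linarith

lemma VV_le (n : ℕ) : ∃ ω : ℝ, 0 ≤ ω ∧ ∀ r : ℝ, 0 ≤ r → VV n r ≤ ω * r ^ n := by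
  refine ⟨(volume : Measure (EuclideanSpace ℝ (Fin n))).real (ball 0 1), measureReal_nonneg,
    fun r hr => ?_⟩
  unfold VV
  rw [setIntegral_const, smul_eq_mul, mul_one]
  refine (measureReal_mono (SS_sub_ball n r) (measure_ball_lt_top).ne).trans ?_
  rcases hr.eq_or_lt with h | h
  · rw [← h]; simp; positivity
  · rw [measureReal_def, Measure.addHaar_ball_of_pos _ _ h]
    simp [measureReal_def, ENNReal.toReal_mul, ENNReal.toReal_ofReal (pow_nonneg hr n), mul_comm]

lemma sum_ineq {A V : ℝ → ℝ} {ε C : ℝ} (hA : Monotone A) (hA0 : ∀ r, 0 ≤ A r)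
    (hV0 : ∀ r, 0 ≤ V r) (hε : 0 < ε) (hC : 0 ≤ C)
    (h : ∀ r, A r ≤ ε * (V (r + 2) - V r) + C * (A (r + 2) - A r)) (N : ℕ) :
    N * A N ≤ ε * V (3 * N) + C * A (3 * N) := by
  have h1 : ∀ k ∈ Finset.range N, A N ≤
      (ε * V (N + 2 * ((k + 1 : ℕ) : ℝ)) + C * A (N + 2 * ((k + 1 : ℕ) : ℝ)))
        - (ε * V (N + 2 * (k : ℝ)) + C * A (N + 2 * (k : ℝ))) := by
    intro k _
    have a1 : A N ≤ A (N + 2 * (k : ℝ)) := hA (by simp)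
    have a2 := h (N + 2 * (k : ℝ))
    have a3 : (N : ℝ) + 2 * ((k + 1 : ℕ) : ℝ) = N + 2 * (k : ℝ) + 2 := by push_cast; ring
    rw [a3]; linarith
  have h2 := Finset.sum_le_sum h1
  rw [Finset.sum_range_sub (fun k : ℕ => ε * V (N + 2 * (k : ℝ)) + C * A (N + 2 * (k : ℝ)))] at h2
  simp only [Finset.sum_const, Finset.card_range, nsmul_eq_mul] at h2
  have a4 : (N : ℝ) + 2 * N = 3 * N := by ring
  rw [a4] at h2
  have := mul_nonneg hε.le (hV0 (N + 2 * ((0 : ℕ) : ℝ)))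
  have := mul_nonneg hC (hA0 (N + 2 * ((0 : ℕ) : ℝ)))
  linarith

lemma decay_abstract {A V : ℝ → ℝ} (k : ℕ) (hA : Monotone A) (hA0 : ∀ r, 0 ≤ A r)
    (hV0 : ∀ r, 0 ≤ V r)
    (h : ∀ ε > 0, ∃ C, 0 ≤ C ∧ ∀ r, A r ≤ ε * (V (r + 2) - V r) + C * (A (r + 2) - A r))
    {ω M : ℝ} (hω : 0 ≤ ω) (hM : 0 ≤ M) (hV : ∀ r, 0 ≤ r → V r ≤ ω * r ^ (k + 1))
    (hAV : ∀ r, A r ≤ M * V r) :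
    ∀ ε > 0, ∃ N0 : ℕ, ∀ N : ℕ, N0 ≤ N → A N ≤ ε * N ^ k := by
  have hcrude : ∃ D, 0 ≤ D ∧ ∀ N : ℕ, 1 ≤ N → A N ≤ D * N ^ k := by
    obtain ⟨C, hC, hr⟩ := h 1 one_pos
    refine ⟨(1 + C * M) * (ω * 3 ^ (k + 1)), by positivity, fun N hN => ?_⟩
    have hNp : (0 : ℝ) < N := by exact_mod_cast hN
    have h1 := sum_ineq hA hA0 hV0 one_pos hC hr N
    have h2 := hV (3 * N) (by positivity)
    have h3 := mul_le_mul_of_nonneg_left (hAV (3 * N)) hC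
    have h4 : N * A N ≤ (1 + C * M) * (ω * (3 * N) ^ (k + 1)) := by
      have := mul_le_mul_of_nonneg_left h2 (show 0 ≤ 1 + C * M by positivity)
      linarith
    refine le_of_mul_le_mul_left (h4.trans (le_of_eq ?_)) hNp
    ring
  obtain ⟨D, hD, hcr⟩ := hcrude
  intro ε hε
  have hden : 0 < 2 * (ω * 3 ^ (k + 1) + 1) := by positivity
  obtain ⟨C, hC, hr⟩ := h (ε / (2 * (ω * 3 ^ (k + 1) + 1))) (by positivity)
  obtain ⟨N1, hN1⟩ := exists_nat_ge (2 * (C * D * 3 ^ k) / ε)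
  refine ⟨max N1 1, fun N hN => ?_⟩
  have hNge1 : 1 ≤ N := (le_max_right _ _).trans hN
  have hNp : (0 : ℝ) < N := by exact_mod_cast hNge1
  have hNN1 : (N1 : ℝ) ≤ N := by exact_mod_cast (le_max_left _ _).trans hN
  have h0 : 2 * (C * D * 3 ^ k) ≤ N * ε := by
    rw [← div_le_iff₀ hε]; exact hN1.trans hNN1
  set ε' := ε / (2 * (ω * 3 ^ (k + 1) + 1)) with hε'
  have hε'p : 0 < ε' := by positivity
  have h1 := sum_ineq hA hA0 hV0 hε'p hC hr N
  have h2 := mul_le_mul_of_nonneg_left (hV (3 * N) (by positivity)) hε'p.le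
  have h3 := hcr (3 * N) (by omega)
  push_cast at h3
  have h3' := mul_le_mul_of_nonneg_left h3 hC
  have h5 : ε' * (ω * 3 ^ (k + 1)) ≤ ε / 2 := by
    have : ε' * (2 * (ω * 3 ^ (k + 1) + 1)) = ε := div_mul_cancel₀ _ hden.ne'
    linarith
  have hNk : (0 : ℝ) ≤ (N : ℝ) ^ k := by positivity
  refine le_of_mul_le_mul_left ?_ hNp
  calc N * A N ≤ ε' * (ω * (3 * N) ^ (k + 1)) + C * (D * (3 * N) ^ k) := by linarith
    _ = (ε' * (ω * 3 ^ (k + 1)) * N + C * D * 3 ^ k) * N ^ k := by ring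
    _ ≤ (ε / 2 * N + N * ε / 2) * N ^ k := by
      refine mul_le_mul_of_nonneg_right (add_le_add ?_ (by linarith)) hNk
      exact mul_le_mul_of_nonneg_right h5 hNp.le
    _ = N * (ε * N ^ k) := by ring

/-- Cut-off monotonicity estimate with explicit weight. -/
lemma weighted_bound {k m : ℕ} {u : EuclideanSpace ℝ (Fin (k + 1)) → EuclideanSpace ℝ (Fin m)}
    {W : EuclideanSpace ℝ (Fin m) → ℝ} (hW : ContDiff ℝ 1 W)
    (hu : ContDiff ℝ 2 u) (hsol : ∀ x, vlap u x = gradient W (u x))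
    (hd0 : ∀ x, 0 ≤ dens W u x)
    (hmodica : ∀ x, (1 / 2) * gradSq u x ≤ W (u x)) {K : ℝ} (hK0 : 0 ≤ K)
    (hK : ∀ t, 0 ≤ deriv Real.smoothTransition t ∧
      deriv Real.smoothTransition t ≤ K ∧ (t < 0 → deriv Real.smoothTransition t = 0) ∧
      (1 < t → deriv Real.smoothTransition t = 0)) (N : ℕ) (hN : 1 ≤ N) :
    ∫ x, dens W u x * (k * ((rho x ^ (k + 2))⁻¹ * Real.smoothTransition (2 - rho x / N)))
      ≤ 2 * K * ((N : ℝ) ^ k)⁻¹ * AA W u (3 * N) := by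
  have hNp : (0 : ℝ) < N := by exact_mod_cast hN
  have hdc : Continuous (dens W u) := (contDiff_dens hW hu).continuous
  set g : ℝ → ℝ := fun t => (t ^ k)⁻¹ * Real.smoothTransition (2 - t / N) with hg
  set g' : ℝ → ℝ := fun t => -(k * (t ^ (k + 1))⁻¹) * Real.smoothTransition (2 - t / N) +
    (t ^ k)⁻¹ * (deriv Real.smoothTransition (2 - t / N) * -(1 / N)) with hg'
  have hgd : ∀ t, 0 < t → HasDerivAt g (g' t) t := by
    intro t ht
    have h1 : HasDerivAt (fun t : ℝ => (t ^ k)⁻¹) (-(k * (t ^ (k + 1))⁻¹)) t := by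
      refine ((hasDerivAt_pow k t).fun_inv (by positivity)).congr_deriv ?_
      rcases k with _ | k
      · simp
      · have := ht.ne'
        simp only [Nat.add_sub_cancel]
        field_simp
        ring
    have h2 : HasDerivAt (fun t : ℝ => 2 - t / N) (-(1 / N)) t :=
      ((hasDerivAt_id t).div_const (N : ℝ)).const_sub 2
    exact h1.fun_mul (HasDerivAt.comp (h := fun t : ℝ => 2 - t / N) t
      (tau_hasDerivAt (2 - t / N)) h2)
  have hrc : Continuous (rho : EuclideanSpace ℝ (Fin (k + 1)) → ℝ) := continuous_rho
  have hbig : ∀ x : EuclideanSpace ℝ (Fin (k + 1)), 2 * N < rho x →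
      Real.smoothTransition (2 - rho x / N) = 0 := by
    intro x hx
    apply Real.smoothTransition.zero_of_nonpos
    have : 2 ≤ rho x / N := (le_div_iff₀ hNp).2 hx.le
    linarith
  have hηc : ContDiff ℝ 1 (fun x : EuclideanSpace ℝ (Fin (k + 1)) => g (rho x)) := by
    refine ContDiff.mul ?_ ?_
    · exact (contDiff_rho.pow k).inv fun x => (pow_pos (rho_pos x) k).ne'
    · exact (Real.smoothTransition.contDiff (n := 1)).comp
        (contDiff_const.sub (contDiff_rho.div_const _))
  have hcsupp : ∀ f : EuclideanSpace ℝ (Fin (k + 1)) → ℝ, (∀ x, 2 * N < rho x → f x = 0) →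
      HasCompactSupport f := by
    intro f hf
    refine HasCompactSupport.intro (compact_rho_le (k + 1) (2 * N)) fun x hx => hf x ?_
    simpa using hx
  have hfirst_c : Continuous (fun x : EuclideanSpace ℝ (Fin (k + 1)) =>
      dens W u x * (k * ((rho x ^ (k + 2))⁻¹ * Real.smoothTransition (2 - rho x / N)))) := by
    refine hdc.mul (continuous_const.mul (Continuous.mul ?_ ?_))
    · exact (hrc.pow _).inv₀ fun x => (pow_pos (rho_pos x) _).ne'
    · exact Real.smoothTransition.continuous.comp (continuous_const.sub (hrc.div_const _))
  have hfirst_i : Integrable (fun x : EuclideanSpace ℝ (Fin (k + 1)) =>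
      dens W u x * (k * ((rho x ^ (k + 2))⁻¹ * Real.smoothTransition (2 - rho x / N)))) :=
    hfirst_c.integrable_of_hasCompactSupport (hcsupp _ fun x hx => by simp [hbig x hx])
  have hmeas : MeasurableSet (SS (k + 1) (3 * N)) := (isOpen_SS _ _).measurableSet
  have hsec_i : Integrable (fun x => 2 * K * ((N : ℝ) ^ k)⁻¹ *
      (SS (k + 1) (3 * N)).indicator (dens W u) x) :=
    ((integrable_indicator_iff hmeas).2 (integrableOn_SS _ hdc)).const_mul _
  have hmain := weak_monotonicity hW hu hsol hmodica (fun x => g (rho x))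
    (fun x => g' (rho x) * (rho x)⁻¹) hηc
    (hcsupp _ fun x hx => by simp [hg, hbig x hx])
    (fun x => ((hgd _ (rho_pos x)).comp_hasFDerivAt x (hasFDerivAt_rho x)).congr_fderiv
      (by rw [smul_smul]))
    (fun x => mul_nonneg (inv_nonneg.2 (pow_pos (rho_pos x) k).le)
      (Real.smoothTransition.nonneg _))
    (fun x => by
      have hr := rho_pos x
      have h1 := Real.smoothTransition.nonneg (2 - rho x / N)
      have h2 := (hK (2 - rho x / N)).1
      have h3 : g' (rho x) ≤ 0 := by
        have e : g' (rho x) = -((k * (rho x ^ (k + 1))⁻¹) * Real.smoothTransition (2 - rho x / N) +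
          (rho x ^ k)⁻¹ * (deriv Real.smoothTransition (2 - rho x / N) * (1 / N))) := by
          simp only [hg']; ring
        rw [e]
        exact neg_nonpos.2 (by positivity)
      exact mul_nonpos_of_nonpos_of_nonneg h3 (inv_nonneg.2 hr.le))
    _ (hfirst_i.sub hsec_i) (fun x => by
      have hr := rho_pos x
      have hr2 : ‖x‖ ^ 2 = rho x ^ 2 - 1 := by rw [rho_sq]; ring
      set T := Real.smoothTransition (2 - rho x / N) with hT
      set T' := deriv Real.smoothTransition (2 - rho x / N) with hT'
      have hT'0 : 0 ≤ T' := (hK _).1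
      have hT'K : T' ≤ K := (hK _).2.1
      have hid : ((((k + 1 : ℕ) : ℝ) - 1) * g (rho x) + ‖x‖ ^ 2 * (g' (rho x) * (rho x)⁻¹))
          = k * ((rho x ^ (k + 2))⁻¹ * T) - (‖x‖ ^ 2 / rho x) * ((rho x ^ k)⁻¹ * (T' / N)) := by
        simp only [hg, hg', ← hT, ← hT', hr2]
        push_cast
        field_simp
        ring
      rw [hid, mul_sub]
      simp only [Pi.sub_apply]
      refine sub_le_sub_left ?_ _
      rcases lt_or_ge (rho x) N with h | h
      · have : T' = 0 := (hK _).2.2.2 (by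
          have : rho x / N < 1 := (div_lt_one hNp).2 h
          linarith)
        rw [this]
        have : 0 ≤ (SS (k + 1) (3 * N)).indicator (dens W u) x :=
          Set.indicator_nonneg (fun x _ => hd0 x) x
        simp; positivity
      rcases lt_or_ge (2 * (N : ℝ)) (rho x) with h' | h'
      · have : T' = 0 := (hK _).2.2.1 (by
          have : 2 < rho x / N := (lt_div_iff₀ hNp).2 h'
          linarith)
        rw [this]
        have : 0 ≤ (SS (k + 1) (3 * N)).indicator (dens W u) x :=
          Set.indicator_nonneg (fun x _ => hd0 x) x
        simp; positivity
      · have hmem : x ∈ SS (k + 1) (3 * N) := show rho x < 3 * N by linarith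
        rw [Set.indicator_of_mem hmem, mul_comm]
        refine mul_le_mul_of_nonneg_right ?_ (hd0 x)
        have b1 : ‖x‖ ^ 2 / rho x ≤ 2 * N := by
          rw [div_le_iff₀ hr, hr2]; nlinarith
        have b2 : (rho x ^ k)⁻¹ ≤ ((N : ℝ) ^ k)⁻¹ := by gcongr
        have b3 : T' / N ≤ K / N := by gcongr
        calc ‖x‖ ^ 2 / rho x * ((rho x ^ k)⁻¹ * (T' / N))
            ≤ (2 * N) * (((N : ℝ) ^ k)⁻¹ * (K / N)) := by gcongr
          _ = 2 * K * ((N : ℝ) ^ k)⁻¹ := by field_simp)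
  have hsub : ∫ x, ((fun x : EuclideanSpace ℝ (Fin (k + 1)) =>
      dens W u x * (k * ((rho x ^ (k + 2))⁻¹ * Real.smoothTransition (2 - rho x / N)))) -
      fun x => 2 * K * ((N : ℝ) ^ k)⁻¹ * (SS (k + 1) (3 * N)).indicator (dens W u) x) x =
      (∫ x, dens W u x * (k * ((rho x ^ (k + 2))⁻¹ * Real.smoothTransition (2 - rho x / N))))
        - 2 * K * ((N : ℝ) ^ k)⁻¹ * AA W u (3 * N) := by
    rw [integral_sub' hfirst_i hsec_i, integral_const_mul, integral_indicator hmeas]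
    rfl
  rw [hsub] at hmain
  linarith

/-- Theorem 1.3, Case (a) (Modica bound): a bounded globally minimizing solution
satisfying Modica's gradient bound `(1/2)|∇u|² ≤ W(u)` is identically `a`. -/
theorem liouville_of_modica
    (n m : ℕ) (hn : 2 ≤ n) (hm : 1 ≤ m)
    (W : EuclideanSpace ℝ (Fin m) → ℝ) (hW : ContDiff ℝ 1 W)
    (a : EuclideanSpace ℝ (Fin m))
    (hWa : W a = 0) (hWpos : ∀ v, v ≠ a → 0 < W v)
    (u : EuclideanSpace ℝ (Fin n) → EuclideanSpace ℝ (Fin m))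
    (hu : ContDiff ℝ 2 u)
    (hbdd : ∃ C, ∀ x, ‖u x‖ ≤ C)
    (hsol : ∀ x, vlap u x = gradient W (u x))
    (hmin : GloballyMinimizing W u)
    (hmodica : ∀ x, (1 / 2) * gradSq u x ≤ W (u x)) :
    ∀ x, u x = a := by
  obtain ⟨k, rfl⟩ : ∃ k, n = k + 1 := ⟨n - 1, by omega⟩
  have hk : 1 ≤ k := by omega
  have hkp : (0 : ℝ) < k := by exact_mod_cast hk
  have hW0 : ∀ v, 0 ≤ W v := fun v => by
    by_cases h : v = a
    · rw [h, hWa]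
    · exact (hWpos v h).le
  have hd0 : ∀ x, 0 ≤ dens W u x := fun x => by
    have := gradSq_nonneg' u x
    have := hW0 (u x)
    unfold dens; linarith
  have hdc : Continuous (dens W u) := (contDiff_dens hW hu).continuous
  obtain ⟨C0, hC0⟩ := hbdd
  obtain ⟨Q, hQ⟩ := (isCompact_closedBall (0 : EuclideanSpace ℝ (Fin m)) C0).exists_bound_of_continuousOn
    hW.continuous.continuousOn
  have hWQ : ∀ x, W (u x) ≤ Q := fun x =>
    (le_abs_self _).trans (hQ (u x) (by simpa using hC0 x))
  have hQ0 : 0 ≤ Q := (hW0 _).trans (hWQ 0)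
  have hdQ : ∀ x, dens W u x ≤ 2 * Q := fun x => by
    have := hmodica x
    have := hWQ x
    unfold dens; linarith
  obtain ⟨ω, hω, hV⟩ := VV_le (k + 1)
  obtain ⟨K, hK0, hK⟩ := tau_deriv
  have hAmono : Monotone (AA W u) := fun r s hrs =>
    setIntegral_mono_set (integrableOn_SS _ hdc) (Eventually.of_forall hd0)
      (LE.le.eventuallyLE (SS_mono _ hrs))
  have hdecay := decay_abstract (A := AA W u) (V := VV (k + 1)) k hAmono
    (fun r => integral_nonneg hd0) (fun r => integral_nonneg fun _ => zero_le_one)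
    (fun ε hε => layer_ineq hW hWa hWpos hu ⟨C0, hC0⟩ hmin hε) hω
    (show (0 : ℝ) ≤ 2 * Q by positivity) hV
    (fun r => by
      unfold AA VV
      rw [← integral_const_mul]
      exact setIntegral_mono (integrableOn_SS _ hdc) (integrableOn_SS _ continuous_const)
        fun x => by simpa using hdQ x)
  intro x
  by_contra hxa
  have hdx : 0 < dens W u x := by
    have := gradSq_nonneg' u x
    have := hWpos _ hxa
    unfold dens; linarith
  -- the weighted functions
  set F : ℕ → EuclideanSpace ℝ (Fin (k + 1)) → ℝ := fun N y =>
    dens W u y * (k * ((rho y ^ (k + 2))⁻¹ * Real.smoothTransition (2 - rho y / N))) with hF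
  have hrc : Continuous (rho : EuclideanSpace ℝ (Fin (k + 1)) → ℝ) := continuous_rho
  have hFc : ∀ N, Continuous (F N) := by
    intro N
    refine hdc.mul (continuous_const.mul (Continuous.mul ?_ ?_))
    · exact (hrc.pow _).inv₀ fun x => (pow_pos (rho_pos x) _).ne'
    · exact Real.smoothTransition.continuous.comp (continuous_const.sub (hrc.div_const _))
  have hFs : ∀ N : ℕ, 1 ≤ N → HasCompactSupport (F N) := by
    intro N hN
    have hNp : (0 : ℝ) < N := by exact_mod_cast hN
    refine HasCompactSupport.intro (compact_rho_le (k + 1) (2 * N)) fun y hy => ?_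
    have hy' : 2 * (N : ℝ) < rho y := by simpa using hy
    have h2 : 2 ≤ rho y / N := (le_div_iff₀ hNp).2 hy'.le
    have : Real.smoothTransition (2 - rho y / N) = 0 :=
      Real.smoothTransition.zero_of_nonpos (by linarith)
    simp [hF, this]
  have hF0 : ∀ N y, 0 ≤ F N y := fun N y => mul_nonneg (hd0 y) (mul_nonneg hkp.le
    (mul_nonneg (inv_nonneg.2 (pow_pos (rho_pos y) _).le) (Real.smoothTransition.nonneg _)))
  obtain ⟨N1, hN1⟩ := exists_nat_ge (rho x)
  have hN1p : (0 : ℝ) < N1 := (rho_pos x).trans_le hN1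
  have hN1' : 1 ≤ N1 := by exact_mod_cast hN1p
  have hpos : 0 < ∫ y, F N1 y := by
    refine (hFc N1).integral_pos_of_hasCompactSupport_nonneg_nonzero (hFs N1 hN1')
      (hF0 N1) (x := x) ?_
    have h1 : rho x / N1 ≤ 1 := (div_le_one hN1p).2 hN1
    have h2 : Real.smoothTransition (2 - rho x / N1) = 1 :=
      Real.smoothTransition.one_of_one_le (by linarith)
    simp only [hF, h2]
    have := rho_pos x
    positivity
  obtain ⟨I, hI⟩ : ∃ I, I = ∫ y, F N1 y := ⟨_, rfl⟩
  rw [← hI] at hpos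
  have hden : 0 < 2 * (2 * K * 3 ^ k + 1) := by positivity
  obtain ⟨N0, hN0⟩ := hdecay (I / (2 * (2 * K * 3 ^ k + 1))) (div_pos hpos hden)
  set N := max N0 N1 with hNdef
  have hNN0 : N0 ≤ N := le_max_left _ _
  have hNN1 : N1 ≤ N := le_max_right _ _
  have hN : 1 ≤ N := hN1'.trans hNN1
  have hNp : (0 : ℝ) < N := by exact_mod_cast hN
  have hmono : I ≤ ∫ y, F N y := by
    rw [hI]
    refine integral_mono ((hFc N1).integrable_of_hasCompactSupport (hFs N1 hN1'))
      ((hFc N).integrable_of_hasCompactSupport (hFs N hN)) fun y => ?_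
    have hy := rho_pos y
    have h1 : rho y / N ≤ rho y / N1 :=
      div_le_div_of_nonneg_left hy.le hN1p (by exact_mod_cast hNN1)
    have h2 : Real.smoothTransition (2 - rho y / N1) ≤ Real.smoothTransition (2 - rho y / N) :=
      Real.smoothTransition.monotone (by linarith)
    have h3 := hd0 y
    simp only [hF]
    gcongr
  have hb := weighted_bound hW hu hsol hd0 hmodica hK0 hK N hN
  have hA := hN0 (3 * N) (by omega)
  push_cast at hA
  have hNk : (0 : ℝ) < (N : ℝ) ^ k := by positivity
  have hfin : 2 * K * ((N : ℝ) ^ k)⁻¹ * AA W u (3 * N) ≤ I / 2 := by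
    calc 2 * K * ((N : ℝ) ^ k)⁻¹ * AA W u (3 * N)
        ≤ 2 * K * ((N : ℝ) ^ k)⁻¹ * (I / (2 * (2 * K * 3 ^ k + 1)) * (3 * N) ^ k) := by gcongr
      _ = (2 * K * 3 ^ k) * I / (2 * (2 * K * 3 ^ k + 1)) := by
        rw [mul_pow]; field_simp
      _ ≤ I / 2 := by
        rw [div_le_div_iff₀ (by positivity) two_pos]
        nlinarith
  have : I ≤ I / 2 := hmono.trans (hb.trans hfin)
  linarith
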